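/- arXiv:2506.11500 — 3 statements merged into one kernel-verified Lean document; each statement's English description precedes it below -/
import Mathlib

section
/- Let X be an infinite set and let G be a subgroup of Sym(X) with Sym_ω(X) ⊆ G. Then Z±_4(G) = Z±(G) and Z±(G) ≠ Z(G). -/
open Topology TopologicalSpace

/-- Evaluation of the semigroup polynomial `a₀ x a₁ x ⋯ x aₙ`, encoded by its first
coefficient `a` and the list `l = [a₁, …, aₙ]` of remaining coefficients
(so the degree is `l.length`). -/
def sgEval {M : Type*} [Monoid M] (x a : M) (l : List M) : M :=
  a * (l.map (fun b => x * b)).prod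

/-- The semigroup Zariski topology `Z(M)`, generated by the sets
`{x | f x ≠ g x}` with `f, g` semigroup polynomials. -/
def sgZariski (M : Type*) [Monoid M] : TopologicalSpace M :=
  generateFrom {U | ∃ (a : M) (l : List M) (b : M) (m : List M),
    U = {x | sgEval x a l ≠ sgEval x b m}}

/-- The bounded semigroup Zariski topology `Z_n(M)`, generated by the sets
`{x | f x ≠ g x}` with `f, g` semigroup polynomials of degree at most `n`. -/
def sgZariskiLe (M : Type*) [Monoid M] (n : ℕ) : TopologicalSpace M :=
  generateFrom {U | ∃ (a : M) (l : List M) (b : M) (m : List M),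
    l.length ≤ n ∧ m.length ≤ n ∧ U = {x | sgEval x a l ≠ sgEval x b m}}

/-- Evaluation of the group polynomial `a₀ x^{ε₁} a₁ ⋯ x^{εₙ} aₙ`, encoded by its first
coefficient `a` and the list `l = [(ε₁,a₁), …, (εₙ,aₙ)]`, where `true` stands for the
exponent `1` and `false` for the exponent `-1` (so the degree is `l.length`). -/
def gpEval {G : Type*} [Group G] (x a : G) (l : List (Bool × G)) : G :=
  a * (l.map (fun p => (if p.1 then x else x⁻¹) * p.2)).prod

/-- The group Zariski topology `Z±(G)`, generated by the sets `{x | f x ≠ 1}`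
with `f` a group polynomial. -/
def gpZariski (G : Type*) [Group G] : TopologicalSpace G :=
  generateFrom {U | ∃ (a : G) (l : List (Bool × G)), U = {x | gpEval x a l ≠ 1}}

/-- The bounded group Zariski topology `Z±_n(G)`, generated by the sets `{x | f x ≠ 1}`
with `f` a group polynomial of degree at most `n`. -/
def gpZariskiLe (G : Type*) [Group G] (n : ℕ) : TopologicalSpace G :=
  generateFrom {U | ∃ (a : G) (l : List (Bool × G)), l.length ≤ n ∧ U = {x | gpEval x a l ≠ 1}}

/-- Forward track of a point `u` under the word `c₁ s c₂ s ⋯ cₙ s`. -/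
def trk {X : Type*} (s : X → X) (u : X) (L : List (Equiv.Perm X)) : X :=
  L.foldr (fun c y => c (s y)) u

theorem trk_inj {X : Type*} (s : X → X) (C : Finset (Equiv.Perm X)) (U : Finset X)
    (Y : Set X) (hU : ∀ u ∈ U, u ∈ Y) (hY : ∀ c ∈ C, ∀ y ∈ Y, c (s y) ∈ Y)
    (h1 : ∀ y ∈ Y, ∀ y' ∈ Y, ∀ c ∈ C, ∀ c' ∈ C, c (s y) = c' (s y') → y = y')
    (h2 : ∀ c ∈ C, ∀ y ∈ Y, c (s y) ∉ U) (u v : X) (hu : u ∈ U) (hv : v ∈ U)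
    (L L' : List (Equiv.Perm X)) (hL : ∀ c ∈ L, c ∈ C) (hL' : ∀ c ∈ L', c ∈ C)
    (h : trk s u L = trk s v L') : u = v ∧ L.length = L'.length := by
  have hmem : ∀ (u : X) (L : List (Equiv.Perm X)), u ∈ U → (∀ c ∈ L, c ∈ C) → trk s u L ∈ Y := by
    intro u L hu
    induction L with
    | nil => intro _; exact hU u hu
    | cons c L ih =>
      intro hL
      exact hY c (hL c (by simp)) _ (ih (fun d hd => hL d (by simp [hd])))
  induction L generalizing L' with
  | nil =>
    cases L' with
    | nil => exact ⟨h, rfl⟩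
    | cons c L' =>
      exfalso
      refine h2 c (hL' c (by simp)) (trk s v L')
        (hmem v L' hv (fun d hd => hL' d (by simp [hd]))) ?_
      have : u = c (s (trk s v L')) := h
      rw [← this]; exact hu
  | cons c L ih =>
    cases L' with
    | nil =>
      exfalso
      refine h2 c (hL c (by simp)) (trk s u L)
        (hmem u L hu (fun d hd => hL d (by simp [hd]))) ?_
      have : c (s (trk s u L)) = v := h
      rw [this]; exact hv
    | cons c' L' =>
      have h' : c (s (trk s u L)) = c' (s (trk s v L')) := h
      have := ih L' (fun d hd => hL d (by simp [hd])) (fun d hd => hL' d (by simp [hd]))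
        (h1 _ (hmem u L hu (fun d hd => hL d (by simp [hd]))) _
          (hmem v L' hv (fun d hd => hL' d (by simp [hd]))) c (hL c (by simp))
          c' (hL' c' (by simp)) h')
      simpa using this

/-- A finite partial injection extends to a finitely supported permutation. -/
theorem exists_ext {X : Type*} (F : Finset X) (s : X → X) (hs : Set.InjOn s F) :
    ∃ x : Equiv.Perm X, {y | x y ≠ y}.Finite ∧ ∀ y ∈ F, x y = s y := by
  classical
  let T : Finset X := F ∪ F.image s
  let f : {t : T // (t : X) ∈ F} → {t : T // (t : X) ∈ F.image s} := fun t =>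
    ⟨⟨s t.1, Finset.mem_union_right _ (Finset.mem_image_of_mem s t.2)⟩,
      Finset.mem_image_of_mem s t.2⟩
  have hf : Function.Bijective f := by
    constructor
    · rintro ⟨⟨a, ha⟩, ha'⟩ ⟨⟨b, hb⟩, hb'⟩ h
      have h : s a = s b := by simpa [f] using h
      have := hs ha' hb' h
      subst this; rfl
    · rintro ⟨⟨a, ha⟩, ha'⟩
      obtain ⟨b, hb, hb'⟩ := Finset.mem_image.1 ha'
      refine ⟨⟨⟨b, Finset.mem_union_left _ hb⟩, hb⟩, ?_⟩
      subst hb'; rfl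
  let e := Equiv.ofBijective f hf
  let σ : Equiv.Perm T := e.extendSubtype
  refine ⟨Equiv.Perm.ofSubtype σ, ?_, ?_⟩
  · refine T.finite_toSet.subset ?_
    intro y hy
    by_contra hyT
    exact hy (Equiv.Perm.ofSubtype_apply_of_not_mem σ hyT)
  · intro y hy
    have hyT : y ∈ T := Finset.mem_union_left _ hy
    rw [Equiv.Perm.ofSubtype_apply_of_mem σ hyT]
    have := e.extendSubtype_apply_of_mem ⟨y, hyT⟩ hy
    change ((e.extendSubtype ⟨y, hyT⟩ : T) : X) = s y
    rw [this]; rfl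

theorem exists_seq {X : Type*} [Infinite X] (C : Finset (Equiv.Perm X)) (U : Finset X) :
    ∃ f : ℕ → X, (∀ n, ∀ c ∈ C, c (f n) ∉ U) ∧
      ∀ m n, m ≠ n → ∀ c ∈ C, ∀ c' ∈ C, c (f m) ≠ c' (f n) := by
  classical
  obtain ⟨f, h1, h2⟩ := exists_seq_of_forall_finset_exists (fun y : X => ∀ c ∈ C, c y ∉ U)
    (fun y z : X => ∀ c ∈ C, ∀ c' ∈ C, c y ≠ c' z) (by
      intro S _
      obtain ⟨y, hy⟩ := Infinite.exists_notMem_finset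
        ((C.biUnion fun c => U.image c.symm) ∪
          (C.biUnion fun c => C.biUnion fun c' => S.image fun z => c'.symm (c z)))
      simp only [Finset.mem_union, Finset.mem_biUnion, Finset.mem_image, not_or, not_exists,
        not_and] at hy
      refine ⟨y, ?_, ?_⟩
      · intro c hc hU
        exact hy.1 c hc _ hU (by simp)
      · intro z hz c hc c' hc' h
        exact hy.2 c hc c' hc' z hz (by simp [h]))
  refine ⟨f, h1, ?_⟩
  intro m n hmn c hc c' hc' h
  rcases lt_or_gt_of_ne hmn with hlt | hlt
  · exact h2 m n hlt c hc c' hc' h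
  · exact h2 n m hlt c' hc' c hc h.symm

theorem generic_perm {X : Type*} [Infinite X] (C : Finset (Equiv.Perm X)) (U : Finset X)
    (h1C : 1 ∈ C) (N : ℕ) :
    ∃ x : Equiv.Perm X, {y | x y ≠ y}.Finite ∧ ∀ u ∈ U, ∀ v ∈ U,
      ∀ L L' : List (Equiv.Perm X), (∀ c ∈ L, c ∈ C) → (∀ c ∈ L', c ∈ C) →
      L.length ≤ N → L'.length ≤ N → trk x u L = trk x v L' → u = v ∧ L.length = L'.length := by
  classical
  obtain ⟨f, hf1, hf2⟩ := exists_seq C U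
  let Y : Set X := (U : Set X) ∪ ⋃ c ∈ C, Set.range fun n => c (f n)
  have hYc : Y.Countable := by
    refine U.countable_toSet.union ?_
    exact Set.Countable.biUnion C.countable_toSet (fun c _ => Set.countable_range _)
  obtain ⟨e, he⟩ := Set.countable_iff_exists_injOn.1 hYc
  let s : X → X := fun y => f (e y)
  have hU : ∀ u ∈ U, u ∈ Y := fun u hu => Or.inl hu
  have hY : ∀ c ∈ C, ∀ y ∈ Y, c (s y) ∈ Y := fun c hc y _ =>
    Or.inr (Set.mem_biUnion hc ⟨e y, rfl⟩)
  have h1 : ∀ y ∈ Y, ∀ y' ∈ Y, ∀ c ∈ C, ∀ c' ∈ C, c (s y) = c' (s y') → y = y' := by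
    intro y hy y' hy' c hc c' hc' h
    by_contra hne
    exact hf2 _ _ (fun h => hne (he hy hy' h)) c hc c' hc' h
  have h2 : ∀ c ∈ C, ∀ y ∈ Y, c (s y) ∉ U := fun c hc y _ => hf1 _ c hc
  let F : ℕ → Finset X := fun k => Nat.rec U
    (fun _ S => S ∪ C.biUnion fun c => S.image fun y => c (s y)) k
  have hFs : ∀ k, F (k+1) = F k ∪ C.biUnion fun c => (F k).image fun y => c (s y) := fun k => rfl
  have hFmono : Monotone F := monotone_nat_of_le_succ fun k => by
    rw [hFs]; exact Finset.subset_union_left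
  have hFY : ∀ k, ∀ y ∈ F k, y ∈ Y := by
    intro k
    induction k with
    | zero => exact hU
    | succ k ih =>
      intro y hy
      rw [hFs] at hy
      simp only [Finset.mem_union, Finset.mem_biUnion, Finset.mem_image] at hy
      rcases hy with hy | ⟨c, hc, z, hz, rfl⟩
      · exact ih y hy
      · exact hY c hc z (ih z hz)
  obtain ⟨x, hx1, hx2⟩ := exists_ext (F N) s (by
    intro y hy y' hy' h
    exact h1 y (hFY N y hy) y' (hFY N y' hy') 1 h1C 1 h1C (by simpa using h))
  have hT : ∀ u ∈ U, ∀ L : List (Equiv.Perm X), (∀ c ∈ L, c ∈ C) → L.length ≤ N →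
      trk x u L = trk s u L ∧ trk s u L ∈ F L.length := by
    intro u hu L
    induction L with
    | nil => intro _ _; exact ⟨rfl, hu⟩
    | cons c L ih =>
      intro hL hlen
      simp only [List.length_cons] at hlen
      obtain ⟨i1, i2⟩ := ih (fun d hd => hL d (by simp [hd])) (by omega)
      constructor
      · change c (x (trk x u L)) = c (s (trk s u L))
        rw [i1, hx2 _ (hFmono (by omega : L.length ≤ N) i2)]
      · rw [List.length_cons, hFs]
        refine Finset.mem_union_right _ (Finset.mem_biUnion.2 ⟨c, hL c (by simp), ?_⟩)
        exact Finset.mem_image.2 ⟨_, i2, rfl⟩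
  refine ⟨x, hx1, ?_⟩
  intro u hu v hv L L' hL hL' hl hl' h
  rw [(hT u hu L hL hl).1, (hT v hv L' hL' hl').1] at h
  exact trk_inj s C U Y hU hY h1 h2 u v hu hv L L' hL hL' h

theorem sgEval_concat {M : Type*} [Monoid M] (x a : M) (l : List M) (c : M) :
    sgEval x a (l ++ [c]) = sgEval x a l * x * c := by
  simp [sgEval, mul_assoc]

theorem sgEval_cons {M : Type*} [Monoid M] (x a : M) (l : List M) (c : M) :
    sgEval x a (c :: l) = a * x * sgEval x c l := by
  simp [sgEval, mul_assoc]

theorem sgEval_trk {X : Type*} (G : Subgroup (Equiv.Perm X)) (x a : G) (l : List G) (c : G)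
    (w : X) : ((sgEval x a (l ++ [c]) : G) : Equiv.Perm X) w =
      trk (x : Equiv.Perm X) ((c : Equiv.Perm X) w) ((a :: l).map Subtype.val) := by
  induction l generalizing a with
  | nil => simp [sgEval, trk]
  | cons b l ih =>
    rw [List.cons_append, sgEval_cons]
    have := ih b
    simp only [Subgroup.coe_mul, Equiv.Perm.mul_apply, this]
    rfl

theorem reduce {X : Type*} [Infinite X] (G : Subgroup (Equiv.Perm X)) (a : G) (l : List G)
    (b : G) (m : List G) (h : sgEval 1 a l ≠ sgEval 1 b m) :
    ∃ (u v : X) (L L' : List (Equiv.Perm X)), ¬ (u = v ∧ L.length = L'.length) ∧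
      ∀ x : G, sgEval x a l = sgEval x b m →
        trk (x : Equiv.Perm X) u L = trk (x : Equiv.Perm X) v L' := by
  have hw : ∀ c d : G, c ≠ d → ∃ w : X, (c : Equiv.Perm X) w ≠ (d : Equiv.Perm X) w := by
    intro c d hcd
    by_contra hh
    push Not at hh
    exact hcd (Subtype.ext (Equiv.ext hh))
  obtain ⟨w0⟩ : Nonempty X := inferInstance
  induction l using List.reverseRecOn generalizing m with
  | nil =>
    rcases List.eq_nil_or_concat m with rfl | ⟨m, d, rfl⟩
    · obtain ⟨w, hw⟩ := hw a b (by simpa [sgEval] using h)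
      refine ⟨(a : Equiv.Perm X) w, (b : Equiv.Perm X) w, [], [], fun h => hw h.1, ?_⟩
      intro x hx
      have hx : a = b := by simpa [sgEval] using hx
      rw [hx]
    · refine ⟨(a : Equiv.Perm X) w0, (d : Equiv.Perm X) w0, [], (b :: m).map Subtype.val,
        by simp, ?_⟩
      intro x hx
      rw [← sgEval_trk, ← List.concat_eq_append, ← hx]
      simp [sgEval, trk]
  | append_singleton l c ih =>
    rcases List.eq_nil_or_concat m with rfl | ⟨m, d, rfl⟩
    · refine ⟨(c : Equiv.Perm X) w0, (b : Equiv.Perm X) w0, (a :: l).map Subtype.val, [],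
        by simp, ?_⟩
      intro x hx
      rw [← sgEval_trk, hx]
      simp [sgEval, trk]
    · rw [List.concat_eq_append] at h ⊢
      by_cases hcd : c = d
      · subst hcd
        obtain ⟨u, v, L, L', h1, h2⟩ := ih m (by
          intro h'
          rw [sgEval_concat, sgEval_concat, h'] at h
          exact h rfl)
        refine ⟨u, v, L, L', h1, fun x hx => h2 x ?_⟩
        rw [sgEval_concat, sgEval_concat] at hx
        exact mul_right_cancel (mul_right_cancel hx)
      · obtain ⟨w, hw⟩ := hw c d hcd
        refine ⟨(c : Equiv.Perm X) w, (d : Equiv.Perm X) w, (a :: l).map Subtype.val,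
          (b :: m).map Subtype.val, fun h => hw h.1, ?_⟩
        intro x hx
        rw [← sgEval_trk, ← sgEval_trk, hx]

theorem swap_meet {X : Type*} [DecidableEq X] (q c u v : X)
    (h : Equiv.swap q c * Equiv.swap u v * Equiv.swap q c * Equiv.swap u v ≠ 1) :
    q = u ∨ q = v ∨ c = u ∨ c = v := by
  by_contra hh
  push Not at hh
  obtain ⟨h1, h2, h3, h4⟩ := hh
  apply h
  ext z
  simp only [Equiv.Perm.mul_apply, Equiv.Perm.one_apply, Equiv.swap_apply_def]
  grind

theorem swap_noncomm {X : Type*} [DecidableEq X] (q c v : X) (h1 : q ≠ c) (h2 : q ≠ v)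
    (h3 : c ≠ v) :
    Equiv.swap q c * Equiv.swap q v * Equiv.swap q c * Equiv.swap q v ≠ 1 := by
  intro h
  have := congrArg (fun e : Equiv.Perm X => e q) h
  simp only [Equiv.Perm.mul_apply, Equiv.Perm.one_apply, Equiv.swap_apply_def] at this
  grind

theorem isOpen_pt {X : Type*} [Infinite X] (G : Subgroup (Equiv.Perm X))
    (hG : ∀ g : Equiv.Perm X, {x : X | g x ≠ x}.Finite → g ∈ G) (p q : X) :
    IsOpen[gpZariskiLe ↥G 4] {x : G | (x : Equiv.Perm X) p = q} := by
  classical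
  letI := gpZariskiLe ↥G 4
  have hsw : ∀ a b : X, Equiv.swap a b ∈ G := by
    intro a b
    apply hG
    refine (Set.toFinite {a, b}).subset ?_
    intro z hz
    by_contra hzz
    simp only [Set.mem_insert_iff, Set.mem_singleton_iff, not_or] at hzz
    exact hz (Equiv.swap_apply_of_ne_of_ne hzz.1 hzz.2)
  have hop : ∀ a c : X, IsOpen {x : G | Equiv.swap q c *
      Equiv.swap ((x : Equiv.Perm X) p) ((x : Equiv.Perm X) a) * Equiv.swap q c *
      Equiv.swap ((x : Equiv.Perm X) p) ((x : Equiv.Perm X) a) ≠ 1} := by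
    intro a c
    apply isOpen_generateFrom_of_mem
    refine ⟨⟨_, hsw q c⟩, [(true, ⟨_, hsw p a⟩), (false, ⟨_, hsw q c⟩),
      (true, ⟨_, hsw p a⟩), (false, 1)], by simp, ?_⟩
    ext x
    simp only [Set.mem_ofPred_eq, ne_eq, not_iff_not]
    rw [Subtype.ext_iff]
    simp only [Equiv.swap_apply_apply, gpEval]
    simp [mul_assoc]
  rw [isOpen_iff_mem_nhds]
  intro x0 hx0
  have hx0 : (x0 : Equiv.Perm X) p = q := hx0
  obtain ⟨a1, ha1⟩ := Infinite.exists_notMem_finset ({p} : Finset X)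
  obtain ⟨a2, ha2⟩ := Infinite.exists_notMem_finset ({p, a1} : Finset X)
  let B : Finset X := {q, (x0 : Equiv.Perm X) a1, (x0 : Equiv.Perm X) a2}
  obtain ⟨c1, hc1⟩ := Infinite.exists_notMem_finset B
  obtain ⟨c2, hc2⟩ := Infinite.exists_notMem_finset (insert c1 B)
  obtain ⟨c3, hc3⟩ := Infinite.exists_notMem_finset (insert c1 (insert c2 B))
  simp only [B, Finset.mem_insert, Finset.mem_singleton, not_or] at ha1 ha2 hc1 hc2 hc3
  have hn : ∀ a c : X, a ≠ p → c ≠ q → c ≠ (x0 : Equiv.Perm X) a →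
      ∀ᶠ x : G in 𝓝 x0, q = (x : Equiv.Perm X) p ∨ q = (x : Equiv.Perm X) a ∨
        c = (x : Equiv.Perm X) p ∨ c = (x : Equiv.Perm X) a := by
    intro a c hap hcq hca
    refine Filter.mem_of_superset ((hop a c).mem_nhds ?_) (fun x hx => swap_meet _ _ _ _ hx)
    change _ ≠ _
    rw [hx0]
    refine swap_noncomm _ _ _ (Ne.symm hcq) ?_ hca
    intro h
    exact hap ((x0 : Equiv.Perm X).injective (by rw [hx0, ← h]))
  filter_upwards [hn a1 c1 ha1 hc1.1 hc1.2.1, hn a1 c2 ha1 hc2.2.1 hc2.2.2.1,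
    hn a1 c3 ha1 hc3.2.2.1 hc3.2.2.2.1, hn a2 c1 ha2.1 hc1.1 hc1.2.2,
    hn a2 c2 ha2.1 hc2.2.1 hc2.2.2.2, hn a2 c3 ha2.1 hc3.2.2.1 hc3.2.2.2.2]
    with x h1 h2 h3 h4 h5 h6
  have hinj : (x : Equiv.Perm X) a2 ≠ (x : Equiv.Perm X) a1 :=
    fun h => ha2.2 ((x : Equiv.Perm X).injective h)
  change (x : Equiv.Perm X) p = q
  grind

theorem isOpen_eval {X : Type*} (G : Subgroup (Equiv.Perm X)) (t : TopologicalSpace G)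
    (ht : ∀ p q : X, IsOpen {x : G | (x : Equiv.Perm X) p = q}) (a : G) (l : List (Bool × G))
    (p q : X) : IsOpen {x : G | ((gpEval x a l : G) : Equiv.Perm X) p = q} := by
  induction l generalizing a q with
  | nil => simp [gpEval]
  | cons e l ih =>
    obtain ⟨e, b⟩ := e
    have hst : ∀ r s : X, IsOpen {x : G | ((if e then x else x⁻¹ : G) : Equiv.Perm X) r = s} := by
      intro r s
      cases e
      · convert ht s r using 3 with x
        change (x : Equiv.Perm X).symm r = s ↔ _
        rw [Equiv.symm_apply_eq, eq_comm]
      · simpa using ht r s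
    have : {x : G | ((gpEval x a ((e, b) :: l) : G) : Equiv.Perm X) p = q} =
        ⋃ r : X, {x : G | ((gpEval x b l : G) : Equiv.Perm X) p = r} ∩
          {x : G | ((if e then x else x⁻¹ : G) : Equiv.Perm X) r =
            (a : Equiv.Perm X).symm q} := by
      ext x
      have hx : gpEval x a ((e, b) :: l) = a * ((if e then x else x⁻¹) * gpEval x b l) := by
        simp [gpEval, mul_assoc]
      rw [Set.mem_ofPred_eq, hx]
      simp only [Set.mem_iUnion, Set.mem_inter_iff, Set.mem_ofPred_eq, exists_eq_left',
        Subgroup.coe_mul, Equiv.Perm.mul_apply, Equiv.eq_symm_apply]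
    rw [this]
    exact isOpen_iUnion fun r => (ih b r).inter (hst _ _)

/-- If `X` is infinite and `Sym_ω(X) ⊆ G ⊆ Sym(X)`, then `Z±_4(G) = Z±(G) ≠ Z(G)`. -/
theorem statement2 {X : Type*} [Infinite X] (G : Subgroup (Equiv.Perm X))
    (hG : ∀ g : Equiv.Perm X, {x : X | g x ≠ x}.Finite → g ∈ G) :
    gpZariskiLe ↥G 4 = gpZariski ↥G ∧ gpZariski ↥G ≠ sgZariski ↥G := by
  classical
  have heq : gpZariskiLe ↥G 4 = gpZariski ↥G := by
    apply le_antisymm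
    · apply le_generateFrom
      rintro _ ⟨a, l, rfl⟩
      have : {x : G | gpEval x a l ≠ 1} = ⋃ (p : X) (q : X) (_ : q ≠ p),
          {x : G | ((gpEval x a l : G) : Equiv.Perm X) p = q} := by
        ext x
        simp only [Set.mem_ofPred_eq, Set.mem_iUnion, exists_prop, exists_eq_right']
        rw [ne_eq, Subtype.ext_iff, Equiv.ext_iff]
        simp
      rw [this]
      letI := gpZariskiLe ↥G 4
      exact isOpen_iUnion fun p => isOpen_iUnion fun q => isOpen_iUnion fun _ =>
        isOpen_eval G _ (isOpen_pt G hG) a l p q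
    · apply le_generateFrom
      rintro _ ⟨a, l, _, rfl⟩
      exact isOpen_generateFrom_of_mem ⟨a, l, rfl⟩
  refine ⟨heq, ?_⟩
  intro hne
  obtain ⟨p⟩ : Nonempty X := inferInstance
  have hop : IsOpen[sgZariski ↥G] {x : G | (x : Equiv.Perm X) p = p} := by
    rw [← hne, ← heq]
    exact isOpen_pt G hG p p
  letI := sgZariski ↥G
  have hbasis := isTopologicalBasis_of_subbasis (α := G) (t := sgZariski ↥G) rfl
  obtain ⟨V, ⟨S, ⟨hSf, hS⟩, rfl⟩, h1V, hVsub⟩ := hbasis.exists_subset_of_mem_open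
    (show (1 : G) ∈ {x : G | (x : Equiv.Perm X) p = p} by simp) hop
  have hred : ∀ W : S, ∃ (u v : X) (L L' : List (Equiv.Perm X)),
      ¬ (u = v ∧ L.length = L'.length) ∧
      ∀ x : G, x ∉ W.1 → trk (x : Equiv.Perm X) u L = trk (x : Equiv.Perm X) v L' := by
    rintro ⟨W, hW⟩
    obtain ⟨a, l, b, m, hWe⟩ := hS hW
    have h1 : (1 : G) ∈ W := h1V W hW
    rw [hWe] at h1
    obtain ⟨u, v, L, L', h2, h3⟩ := reduce G a l b m h1
    refine ⟨u, v, L, L', h2, fun x hx => h3 x ?_⟩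
    have hx : x ∉ W := hx
    rw [hWe] at hx
    simpa using hx
  choose u v L L' hne' hval using hred
  haveI : Fintype S := hSf.fintype
  let C : Finset (Equiv.Perm X) := insert 1
    (Finset.univ.biUnion fun W : S => (L W).toFinset ∪ (L' W).toFinset)
  let U : Finset X := insert p (Finset.univ.image u ∪ Finset.univ.image v)
  let N : ℕ := 1 + ∑ W : S, ((L W).length + (L' W).length)
  have hN : ∀ W : S, (L W).length + (L' W).length ≤ N := fun W =>
    (Finset.single_le_sum (f := fun W : S => (L W).length + (L' W).length)
      (fun _ _ => Nat.zero_le _) (Finset.mem_univ W)).trans (Nat.le_add_left _ _)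
  obtain ⟨x, hxf, hx⟩ := generic_perm C U (Finset.mem_insert_self _ _) N
  have hxV : (⟨x, hG x hxf⟩ : G) ∈ ⋂₀ S := by
    intro W hW
    by_contra hxW
    refine hne' ⟨W, hW⟩ (hx (u ⟨W, hW⟩) (by simp [U]) (v ⟨W, hW⟩) (by simp [U])
      (L ⟨W, hW⟩) (L' ⟨W, hW⟩) ?_ ?_ ?_ ?_ (hval ⟨W, hW⟩ ⟨x, hG x hxf⟩ hxW))
    · intro c hc
      refine Finset.mem_insert_of_mem (Finset.mem_biUnion.2 ⟨⟨W, hW⟩, Finset.mem_univ _, ?_⟩)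
      simp [hc]
    · intro c hc
      refine Finset.mem_insert_of_mem (Finset.mem_biUnion.2 ⟨⟨W, hW⟩, Finset.mem_univ _, ?_⟩)
      simp [hc]
    · exact (Nat.le_add_right _ _).trans (hN ⟨W, hW⟩)
    · exact (Nat.le_add_left _ _).trans (hN ⟨W, hW⟩)
  have hxp : x p = p := hVsub hxV
  have := hx p (Finset.mem_insert_self _ _) p (Finset.mem_insert_self _ _) [1] []
    (by simp [C]) (by simp) (by simp [N]) (by simp) (by simp [trk, hxp])
  simp at this
end

section
/- For every set X, the semigroup Hausdorff–Markov topology on Sym(X) (the topology whose open sets are exactly the sets open in every Hausdorff semigroup topology on Sym(X)) coincides with the topology of pointwise convergence on Sym(X). -/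
open Topology

/-- The topology of pointwise convergence on `Sym(X) = Equiv.Perm X`: the subspace topology
induced from the product space `X → X`, where `X` carries the discrete topology. -/
def permPtwise (X : Type*) : TopologicalSpace (Equiv.Perm X) :=
  TopologicalSpace.induced (fun (g : Equiv.Perm X) (x : X) => g x)
    (@Pi.topologicalSpace X (fun _ => X) (fun _ => ⊥))

/-- The topology of pointwise convergence on a subgroup `G ≤ Sym(X)`. -/
def subPtwise {X : Type*} (G : Subgroup (Equiv.Perm X)) : TopologicalSpace ↥G :=
  TopologicalSpace.induced Subtype.val (permPtwise X)

open Equiv Filter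

/-- An involution displacing one of two disjoint sets, supported on `D`. -/
theorem exists_displace {X : Type*} (D P Q : Set X) (hP : P ⊆ D) (hQ : Q ⊆ D)
    (hPQ : Disjoint P Q) :
    ∃ σ : Perm X, (∀ a, σ (σ a) = a) ∧ (∀ a, a ∉ D → σ a = a) ∧
      ((∀ a ∈ P, σ a ∉ P) ∨ (∀ a ∈ Q, σ a ∉ Q)) := by
  classical
  have key : ∀ P : Set X, P ⊆ D → Cardinal.mk P ≤ Cardinal.mk (D \ P : Set X) →
      ∃ σ : Perm X, (∀ a, σ (σ a) = a) ∧ (∀ a, a ∉ D → σ a = a) ∧ (∀ a ∈ P, σ a ∉ P) := by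
    intro P hP hle
    obtain ⟨f⟩ := (Cardinal.le_def _ _).1 hle
    let s : X → X := fun a =>
      if h : a ∈ P then (f ⟨a, h⟩ : X)
      else if h' : ∃ p : P, (f p : X) = a then (h'.choose : X) else a
    have s1 : ∀ p : P, s p = f p := fun p => by simp [s]
    have s2 : ∀ p : P, s (f p) = p := fun p => by
      have h1 : (f p : X) ∉ P := (f p).2.2
      have h2 : ∃ q : P, (f q : X) = f p := ⟨p, rfl⟩
      have h3 : h2.choose = p := f.injective (Subtype.ext h2.choose_spec)
      simp only [s, dif_neg h1, dif_pos h2, h3]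
    have s3 : ∀ a, a ∉ P → (¬ ∃ p : P, (f p : X) = a) → s a = a := fun a h h' => by
      simp only [s, dif_neg h, dif_neg h']
    have inv : Function.Involutive s := by
      intro a
      by_cases h : a ∈ P
      · rw [s1 ⟨a, h⟩, s2]
      · by_cases h' : ∃ p : P, (f p : X) = a
        · obtain ⟨p, rfl⟩ := h'
          rw [s2, s1]
        · rw [s3 a h h', s3 a h h']
    refine ⟨inv.toPerm, inv, fun a ha => ?_, fun a ha => ?_⟩
    · refine s3 a (fun h => ha (hP h)) ?_
      rintro ⟨p, rfl⟩
      exact ha (f p).2.1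
    · show s a ∉ P
      rw [s1 ⟨a, ha⟩]
      exact (f _).2.2
  rcases le_total (Cardinal.mk P) (Cardinal.mk (D \ P : Set X)) with h | h
  · obtain ⟨σ, h1, h2, h3⟩ := key P hP h
    exact ⟨σ, h1, h2, Or.inl h3⟩
  · have h4 : Cardinal.mk Q ≤ Cardinal.mk (D \ Q : Set X) := by
      refine le_trans (Cardinal.mk_le_mk_of_subset ?_)
        (le_trans h (Cardinal.mk_le_mk_of_subset ?_))
      · exact fun a ha => ⟨hQ ha, fun h => hPQ.le_bot ⟨h, ha⟩⟩
      · exact fun a ha => ⟨hP ha, fun h => hPQ.le_bot ⟨ha, h⟩⟩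
    obtain ⟨σ, h1, h2, h3⟩ := key Q hQ h4
    exact ⟨σ, h1, h2, Or.inr h3⟩

section
variable {X : Type*} [TopologicalSpace (Perm X)] [ContinuousMul (Perm X)]

theorem conj_mem (σ : Perm X) {V : Set (Perm X)} (hV : V ∈ 𝓝 (1 : Perm X)) :
    {g | σ * g * σ⁻¹ ∈ V} ∈ 𝓝 (1 : Perm X) := by
  have hc : Continuous (fun g : Perm X => σ * g * σ⁻¹) :=
    (continuous_const.mul continuous_id).mul continuous_const
  have := hc.continuousAt (x := 1)
  apply this
  simpa using hV

/-- For an involution, the version used below. -/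
theorem inv_mem (σ : Perm X) (hσ : ∀ a, σ (σ a) = a) {V : Set (Perm X)}
    (hV : V ∈ 𝓝 (1 : Perm X)) :
    {g | σ * g * σ ∈ V} ∈ 𝓝 (1 : Perm X) := by
  have h : σ⁻¹ = σ := by
    ext a
    rw [Perm.inv_eq_iff_eq, hσ]
  have := conj_mem σ hV
  rwa [h] at this

theorem pair_mem [T2Space (Perm X)] {a b c d : X} (hab : a ≠ b)
    (h : (a ≠ c ∧ a ≠ d) ∨ (b ≠ c ∧ b ≠ d)) :
    {g : Perm X | ¬ (g a = c ∧ g b = d)} ∈ 𝓝 (1 : Perm X) := by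
  classical
  have hne : swap a b ≠ swap c d := by
    intro e
    rcases h with ⟨h1, h2⟩ | ⟨h1, h2⟩
    · have := congrArg (fun s : Perm X => s a) e
      simp only [swap_apply_left, swap_apply_of_ne_of_ne h1 h2] at this
      exact hab this.symm
    · have := congrArg (fun s : Perm X => s b) e
      simp only [swap_apply_right, swap_apply_of_ne_of_ne h1 h2] at this
      exact hab this
  have hcl : IsClosed {g : Perm X | g * swap a b = swap c d * g} :=
    isClosed_eq (continuous_id.mul continuous_const) (continuous_const.mul continuous_id)
  have : {g : Perm X | g * swap a b = swap c d * g}ᶜ ∈ 𝓝 (1 : Perm X) :=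
    hcl.isOpen_compl.mem_nhds (by simpa using hne)
  filter_upwards [this] with g hg hg'
  apply hg
  show g * swap a b = swap c d * g
  rw [← hg'.1, ← hg'.2, Equiv.mul_swap_eq_swap_mul]

theorem split {U : Set (Perm X)} (hU : U ∈ 𝓝 (1 : Perm X)) :
    ∃ V ∈ 𝓝 (1 : Perm X), ∀ a ∈ V, ∀ b ∈ V, a * b ∈ U := by
  obtain ⟨V, h1, h2, h3⟩ := exists_open_nhds_one_split hU
  exact ⟨V, h1.mem_nhds h2, h3⟩

theorem stab_all_of_stab (x z : X) (h : {g : Perm X | g x = x} ∈ 𝓝 (1 : Perm X)) :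
    {g : Perm X | g z = z} ∈ 𝓝 (1 : Perm X) := by
  classical
  have := conj_mem (swap x z) h
  filter_upwards [this] with g hg
  have h1 : swap x z (g z) = x := by simpa using hg
  have := congrArg (swap x z) h1
  simpa using this

theorem stab_mem_caseA (x z : X) (hxz : x ≠ z)
    (hA : {g : Perm X | g x ≠ z} ∈ 𝓝 (1 : Perm X)) :
    {g : Perm X | g x = x} ∈ 𝓝 (1 : Perm X) := by
  by_contra hs
  have hs' : {g : Perm X | g z = z} ∉ 𝓝 (1 : Perm X) := fun h => hs (stab_all_of_stab z x h)
  obtain ⟨V₀, hV₀, hmul⟩ := split hA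
  set V := V₀ ∩ {g : Perm X | g x ≠ z} with hVdef
  have hV : V ∈ 𝓝 (1 : Perm X) := inter_mem hV₀ hA
  obtain ⟨σ, s1, s2, s3⟩ := exists_displace ({x, z}ᶜ : Set X)
    {a | a ∈ ({x, z}ᶜ : Set X) ∧ ∃ g ∈ V, g x = a}
    {a | a ∈ ({x, z}ᶜ : Set X) ∧ ∃ g ∈ V, g a = z} (fun a h => h.1) (fun a h => h.1) (by
      rw [Set.disjoint_left]
      rintro a ⟨-, g, hg, rfl⟩ ⟨-, g', hg', h⟩
      exact hmul g' hg'.1 g hg.1 (by simpa using h))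
  have σx : σ x = x := s2 x (by simp)
  have σz : σ z = z := s2 z (by simp)
  have hW := inter_mem hV (inv_mem σ s1 hV)
  have hD : ∀ a, a ≠ x → a ≠ z → a ∈ ({x, z}ᶜ : Set X) := fun a h h' => by simp [h, h']
  rcases s3 with h | h
  · apply hs
    filter_upwards [hW] with g hg
    by_contra hgx
    refine h (g x) ⟨hD _ hgx hg.1.2, g, hg.1, rfl⟩ ⟨hD _ ?_ ?_, σ * g * σ, hg.2, ?_⟩
    · intro e; apply hgx; rw [← s1 (g x), e, σx]
    · intro e; apply hg.1.2; rw [← s1 (g x), e, σz]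
    · simp [σx]
  · apply hs'
    filter_upwards [hW] with g hg
    by_contra hgz
    have ha : g (g⁻¹ z) = z := by simp
    have h1 : g⁻¹ z ≠ z := fun e => hgz (by rw [e] at ha; exact ha)
    have h2 : g⁻¹ z ≠ x := fun e => hg.1.2 (by rw [e] at ha; exact ha)
    refine h (g⁻¹ z) ⟨hD _ h2 h1, g, hg.1, ha⟩ ⟨hD _ ?_ ?_, σ * g * σ, hg.2, ?_⟩
    · intro e; apply h2; rw [← s1 (g⁻¹ z), e, σx]
    · intro e; apply h1; rw [← s1 (g⁻¹ z), e, σz]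
    · simp [s1, σz]

theorem caseB_false [T2Space (Perm X)] (x y z t : X) (hxy : x ≠ y) (hxz : x ≠ z) (hxt : x ≠ t)
    (hyz : y ≠ z) (hyt : y ≠ t) (hzt : z ≠ t)
    (h1 : {g : Perm X | g x ≠ z} ∉ 𝓝 (1 : Perm X))
    (h2 : {g : Perm X | g z ≠ x} ∉ 𝓝 (1 : Perm X)) : False := by
  obtain ⟨V₀, hV₀, hmul⟩ := split
    (pair_mem (a := x) (b := y) (c := x) (d := t) hxy (Or.inr ⟨hxy.symm, hyt⟩))
  set V := V₀ ∩ (({g : Perm X | ¬ (g x = z ∧ g y = x)} ∩ {g : Perm X | ¬ (g x = z ∧ g y = y)} ∩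
    {g : Perm X | ¬ (g x = z ∧ g y = t)}) ∩
    ({g : Perm X | ¬ (g z = x ∧ g x = t)} ∩ {g : Perm X | ¬ (g z = x ∧ g y = t)} ∩
    {g : Perm X | ¬ (g z = x ∧ g t = t)})) with hVdef
  have hV : V ∈ 𝓝 (1 : Perm X) := by
    refine inter_mem hV₀ (inter_mem (inter_mem (inter_mem ?_ ?_) ?_)
      (inter_mem (inter_mem ?_ ?_) ?_))
    · exact pair_mem hxy (Or.inr ⟨hyz, hxy.symm⟩)
    · exact pair_mem hxy (Or.inl ⟨hxz, hxy⟩)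
    · exact pair_mem hxy (Or.inl ⟨hxz, hxt⟩)
    · exact pair_mem hxz.symm (Or.inl ⟨hxz.symm, hzt⟩)
    · exact pair_mem hyz.symm (Or.inl ⟨hxz.symm, hzt⟩)
    · exact pair_mem hzt (Or.inl ⟨hxz.symm, hzt⟩)
  obtain ⟨σ, s1, s2, s3⟩ := exists_displace ({x, y, z, t}ᶜ : Set X)
    {a | a ∈ ({x, y, z, t}ᶜ : Set X) ∧ ∃ g ∈ V, g x = z ∧ g y = a}
    {a | a ∈ ({x, y, z, t}ᶜ : Set X) ∧ ∃ g ∈ V, g z = x ∧ g a = t}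
    (fun a h => h.1) (fun a h => h.1) (by
      rw [Set.disjoint_left]
      rintro a ⟨-, g, hg, e, rfl⟩ ⟨-, g', hg', e', h⟩
      exact hmul g' hg'.1 g hg.1 (by simp [e, e', h]))
  have σx : σ x = x := s2 x (by simp)
  have σy : σ y = y := s2 y (by simp)
  have σz : σ z = z := s2 z (by simp)
  have σt : σ t = t := s2 t (by simp)
  have hW := inter_mem hV (inv_mem σ s1 hV)
  have hD : ∀ a, a ≠ x → a ≠ y → a ≠ z → a ≠ t → a ∈ ({x, y, z, t}ᶜ : Set X) :=
    fun a h h' h'' h''' => by simp [h, h', h'', h''']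
  -- elements of `V` land in the complement
  have hP : ∀ g ∈ V, g x = z → g y ∈ ({x, y, z, t}ᶜ : Set X) := by
    rintro g ⟨-, ⟨⟨a1, a2⟩, a3⟩, -⟩ e
    refine hD _ (fun e' => a1 ⟨e, e'⟩) (fun e' => a2 ⟨e, e'⟩) (fun e' => ?_)
      (fun e' => a3 ⟨e, e'⟩)
    exact hxy (g.injective (e.trans e'.symm))
  have hQ : ∀ g ∈ V, g z = x → ∀ a, g a = t → a ∈ ({x, y, z, t}ᶜ : Set X) := by
    rintro g ⟨-, -, ⟨a1, a2⟩, a3⟩ e a ha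
    refine hD _ ?_ ?_ ?_ ?_
    · rintro rfl; exact a1 ⟨e, ha⟩
    · rintro rfl; exact a2 ⟨e, ha⟩
    · rintro rfl; exact hxt (e.symm.trans ha)
    · rintro rfl; exact a3 ⟨e, ha⟩
  rcases s3 with h | h
  · apply h1
    filter_upwards [hW] with g hg hgx
    have e1 : (σ * g * σ) x = z := by simp [σx, hgx, σz]
    have e2 : (σ * g * σ) y = σ (g y) := by simp [σy]
    refine h (g y) ⟨hP g hg.1 hgx, g, hg.1, hgx, rfl⟩ ⟨?_, σ * g * σ, hg.2, e1, e2⟩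
    rw [← e2]
    exact hP _ hg.2 e1
  · apply h2
    filter_upwards [hW] with g hg hgz
    have ha : g (g⁻¹ t) = t := by simp
    have e1 : (σ * g * σ) z = x := by simp [σz, hgz, σx]
    have e2 : (σ * g * σ) (σ (g⁻¹ t)) = t := by simp [s1, σt]
    exact h (g⁻¹ t) ⟨hQ g hg.1 hgz _ ha, g, hg.1, hgz, ha⟩
      ⟨hQ _ hg.2 e1 _ e2, σ * g * σ, hg.2, e1, e2⟩

theorem stab_mem [T2Space (Perm X)] (x : X) :
    {g : Perm X | g x = x} ∈ 𝓝 (1 : Perm X) := by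
  classical
  rcases finite_or_infinite X with hX | hX
  · exact (isOpen_discrete _).mem_nhds (by simp)
  · obtain ⟨y, hy⟩ := Infinite.exists_notMem_finset ({x} : Finset X)
    obtain ⟨z, hz⟩ := Infinite.exists_notMem_finset ({x, y} : Finset X)
    obtain ⟨t, ht⟩ := Infinite.exists_notMem_finset ({x, y, z} : Finset X)
    simp only [Finset.mem_insert, Finset.mem_singleton, not_or] at hy hz ht
    by_contra hs
    refine caseB_false x y z t (Ne.symm hy) (Ne.symm hz.1) (Ne.symm ht.1) (Ne.symm hz.2)
      (Ne.symm ht.2.1) (Ne.symm ht.2.2) ?_ ?_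
    · exact fun h => hs (stab_mem_caseA x z (Ne.symm hz.1) h)
    · exact fun h => hs (stab_all_of_stab z x (stab_mem_caseA z x hz.1 h))

theorem isOpen_eval_s8 [T2Space (Perm X)] (x y : X) : IsOpen {g : Perm X | g x = y} := by
  rw [isOpen_iff_mem_nhds]
  rintro g₀ rfl
  have hc : Continuous (fun g : Perm X => g₀⁻¹ * g) := continuous_const.mul continuous_id
  have h : (fun g : Perm X => g₀⁻¹ * g) ⁻¹' {g : Perm X | g x = x} ∈ 𝓝 g₀ := by
    apply hc.continuousAt
    simpa using stab_mem x
  filter_upwards [h] with g hg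
  have : g₀⁻¹ (g x) = x := hg
  exact (Perm.inv_eq_iff_eq.1 this)

end

theorem permPtwise_isOpen_eval {X : Type*} (x y : X) :
    IsOpen[permPtwise X] {g : Perm X | g x = y} := by
  letI : TopologicalSpace X := ⊥
  haveI : DiscreteTopology X := ⟨rfl⟩
  refine isOpen_induced_iff.2 ⟨{f : X → X | f x = y}, ?_, rfl⟩
  have hc : Continuous (fun f : X → X => f x) := continuous_apply x
  exact hc.isOpen_preimage _ (isOpen_discrete ({y} : Set X))

theorem continuous_to_permPtwise {X Y : Type*} [TopologicalSpace Y] (f : Y → Perm X)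
    (h : ∀ x y, IsOpen {a | f a x = y}) : @Continuous _ _ _ (permPtwise X) f := by
  letI : TopologicalSpace X := ⊥
  haveI : DiscreteTopology X := ⟨rfl⟩
  refine continuous_induced_rng.2 (continuous_pi fun x => ?_)
  rw [continuous_discrete_rng]
  exact fun y => h x y

/-- For every set `X`, the semigroup Hausdorff–Markov topology on `Sym(X)` — whose open sets
are exactly the sets open in every Hausdorff semigroup topology on `Sym(X)` — coincides with
the topology of pointwise convergence: a set is open in the topology of pointwise convergence
iff it is open in every Hausdorff topology on `Sym(X)` with continuous multiplication. -/
theorem statement8 (X : Type*) (U : Set (Equiv.Perm X)) :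
    IsOpen[permPtwise X] U ↔
      ∀ t : TopologicalSpace (Equiv.Perm X), @T2Space (Equiv.Perm X) t →
        @Continuous (Equiv.Perm X × Equiv.Perm X) (Equiv.Perm X)
          (@instTopologicalSpaceProd _ _ t t) t (fun p => p.1 * p.2) →
        IsOpen[t] U := by
  constructor
  · intro hU t ht hc
    letI := t
    haveI : ContinuousMul (Equiv.Perm X) := ⟨hc⟩
    have := continuous_to_permPtwise (fun g : Equiv.Perm X => g) (fun x y => isOpen_eval_s8 x y)
    exact (@Continuous.isOpen_preimage _ _ t (permPtwise X) _ this U hU)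
  · intro h
    refine h (permPtwise X) ?_ ?_
    · letI := permPtwise X
      refine ⟨fun g g' hne => ?_⟩
      obtain ⟨x, hx⟩ : ∃ x, g x ≠ g' x := by
        by_contra hcon
        push Not at hcon
        exact hne (Equiv.ext hcon)
      refine ⟨_, _, permPtwise_isOpen_eval x (g x), permPtwise_isOpen_eval x (g' x), rfl, rfl, ?_⟩
      rw [Set.disjoint_left]
      intro k hk hk'
      exact hx (Eq.trans (Eq.symm hk) hk')
    · letI := permPtwise X
      refine continuous_to_permPtwise _ (fun x y => ?_)
      have : {a : Equiv.Perm X × Equiv.Perm X | (a.1 * a.2) x = y} =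
          ⋃ w : X, {g : Equiv.Perm X | g w = y} ×ˢ {g : Equiv.Perm X | g x = w} := by
        ext a
        simp
      rw [this]
      exact isOpen_iUnion fun w => (permPtwise_isOpen_eval w y).prod (permPtwise_isOpen_eval x w)
end

section
/- For every set X, every Hausdorff topology on Sym(X) for which the multiplication map Sym(X) × Sym(X) → Sym(X) is continuous contains the topology of pointwise convergence, i.e., every set open in the topology of pointwise convergence is open in every Hausdorff semigroup topology on Sym(X). -/
open Topology

open Cardinal in
/-- Every infinite set splits into two pieces of full cardinality. -/
theorem aux_split {X : Type*} (S : Set X) (hS : S.Infinite) :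
    ∃ A B : Set X, A ∪ B = S ∧ Disjoint A B ∧ #A = #S ∧ #B = #S := by
  obtain ⟨A, B, h1, h2, h3⟩ := hS.exists_union_disjoint_cardinal_eq_of_infinite
  have h4 : #S = #A + #B := by rw [← h1, mk_union_of_disjoint h2]
  have hS' : ℵ₀ ≤ #S := by
    have := hS.to_subtype
    exact aleph0_le_mk _
  rw [← h3] at h4
  have hA : ℵ₀ ≤ #A := by
    by_contra hlt
    push Not at hlt
    exact absurd (h4 ▸ add_lt_aleph0 hlt hlt) (not_lt.2 hS')
  rw [add_eq_self hA] at h4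
  exact ⟨A, B, h1, h2, h4.symm, by rw [← h3, h4]⟩

open Cardinal in
theorem aux_compl {X : Type*} (A B : Set X) (hAB : Disjoint A B) (h : #A = #B)
    (hA : ℵ₀ ≤ #A) : #(Aᶜ : Set X) = #X := by
  have h1 : #A ≤ #(Aᶜ : Set X) := by
    rw [h]
    exact mk_le_mk_of_subset hAB.subset_compl_left
  rw [← mk_sum_compl A, add_eq_right (hA.trans h1) h1]

open Cardinal in
theorem aux_perm {X : Type*} (A B C D : Set X) (hAB : Disjoint A B) (hCD : Disjoint C D)
    (h1 : #A = #B) (h2 : #C = #D) (h3 : #A = #C) (hA : ℵ₀ ≤ #A) :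
    ∃ c : Equiv.Perm X, ∀ z, c z ∈ C ↔ z ∈ A := by
  classical
  have e2 : #(Aᶜ : Set X) = #(Cᶜ : Set X) := by
    rw [aux_compl A B hAB h1 hA, aux_compl C D hCD h2 (h3 ▸ hA)]
  obtain ⟨e⟩ := Cardinal.eq.1 h3
  obtain ⟨e'⟩ := Cardinal.eq.1 e2
  refine ⟨(Equiv.Set.sumCompl A).symm.trans ((Equiv.sumCongr e e').trans
    (Equiv.Set.sumCompl C)), fun z => ?_⟩
  by_cases hz : z ∈ A
  · simp [Equiv.Set.sumCompl_symm_apply_of_mem hz, hz]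
  · simp only [Equiv.trans_apply, Equiv.Set.sumCompl_symm_apply_of_notMem hz, hz, iff_false]
    exact (e' ⟨z, hz⟩).2

/-- The points to which elements of `V` move `x`. -/
def mvB {X : Type*} (x : X) (V : Set (Equiv.Perm X)) : Set X :=
  {b | b ≠ x ∧ ∃ g ∈ V, g x = b}

/-- The points which elements of `V` move to `x`. -/
def mvE {X : Type*} (x : X) (V : Set (Equiv.Perm X)) : Set X :=
  {b | b ≠ x ∧ ∃ g ∈ V, g b = x}

open Cardinal in
theorem aux_trans1 {X : Type*} (N : Filter (Equiv.Perm X))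
    (hmul : ∀ U ∈ N, ∃ V ∈ N, ∀ g ∈ V, ∀ h ∈ V, g * h ∈ U)
    (hconj : ∀ U ∈ N, ∀ c : Equiv.Perm X, {g | c * g * c⁻¹ ∈ U} ∈ N)
    (x : X) (hx : ∀ U ∈ N, ∃ g ∈ U, g x ≠ x)
    (V0 : Set (Equiv.Perm X)) (hV0 : V0 ∈ N)
    (hB : ∀ U ∈ N, #(mvB x V0) ≤ #(mvB x U)) (hE : ∀ U ∈ N, #(mvB x V0) ≤ #(mvE x U))
    (U : Set (Equiv.Perm X)) (hU : U ∈ N) (y : X) (hy : y ≠ x) : ∃ w ∈ U, w x = y := by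
  classical
  rcases (mvB x V0).finite_or_infinite with hfin | hinf
  · -- finite case
    obtain ⟨g0, hg0, hg0x⟩ := hx V0 hV0
    have hc := hconj U hU (Equiv.swap (g0 x) y)
    set U' := {g : Equiv.Perm X | Equiv.swap (g0 x) y * g * (Equiv.swap (g0 x) y)⁻¹ ∈ U}
    have hI : U' ∩ V0 ∈ N := Filter.inter_mem hc hV0
    have hsub : mvB x (U' ∩ V0) ⊆ mvB x V0 := by
      rintro b ⟨hb, g, hg, hgb⟩
      exact ⟨hb, g, hg.2, hgb⟩
    have heq : mvB x (U' ∩ V0) = mvB x V0 := by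
      have hfin' := hfin.subset hsub
      apply Set.eq_of_subset_of_ncard_le hsub _ hfin
      have := hB _ hI
      exact Cardinal.toNat_le_toNat this (by
        have := hfin'.to_subtype
        exact Cardinal.mk_lt_aleph0)
    have hm : g0 x ∈ mvB x (U' ∩ V0) := by
      rw [heq]; exact ⟨hg0x, g0, hg0, rfl⟩
    obtain ⟨_, g, hg, hgx⟩ := hm
    refine ⟨_, hg.1, ?_⟩
    simp [Equiv.Perm.mul_apply, Equiv.swap_apply_of_ne_of_ne hg0x.symm hy.symm, hgx]
  · have hinf' : ℵ₀ ≤ #(mvB x V0) := by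
      have := hinf.to_subtype
      exact aleph0_le_mk _
    -- positive half of the set of images
    obtain ⟨A, B, hAB, hdAB, hcA, hcB, hpos⟩ : ∃ A B : Set X, A ∪ B = mvB x V0 ∧ Disjoint A B ∧
        #A = #(mvB x V0) ∧ #B = #(mvB x V0) ∧ ∀ W ∈ N, ∃ g ∈ W, g x ∈ A := by
      obtain ⟨A, B, h1, h2, h3, h4⟩ := aux_split _ hinf
      by_cases hp : ∀ W ∈ N, ∃ g ∈ W, g x ∈ A
      · exact ⟨A, B, h1, h2, h3, h4, hp⟩
      · push Not at hp
        obtain ⟨W1, hW1, hn⟩ := hp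
        refine ⟨B, A, by rw [Set.union_comm, h1], h2.symm, h4, h3, fun W hW => ?_⟩
        obtain ⟨g, ⟨⟨hgW, hgW1⟩, hgV⟩, hgx⟩ :=
          hx _ (Filter.inter_mem (Filter.inter_mem hW hW1) hV0)
        have : g x ∈ A ∪ B := by rw [h1]; exact ⟨hgx, g, hgV, rfl⟩
        exact ⟨g, hgW, this.resolve_left (hn g hgW1)⟩
    obtain ⟨V1, hV1, hV1U⟩ := hmul U hU
    obtain ⟨V2, hV2, hV2U⟩ := hmul V1 hV1
    obtain ⟨g0, hg0, hg0x⟩ := hx V2 hV2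
    have hVs := hconj V1 hV1 (Equiv.swap x y)
    set Vs := {g : Equiv.Perm X | Equiv.swap x y * g * (Equiv.swap x y)⁻¹ ∈ V1} with hVsdef
    obtain ⟨E0, hE0, hE0c⟩ : ∃ E0 : Set X, E0 ⊆ Equiv.swap x y '' mvE x Vs ∧
        #E0 = #(mvB x V0) := by
      apply le_mk_iff_exists_subset.1
      rw [mk_image_eq (Equiv.injective _)]
      exact hE _ hVs
    have hE0inf : E0.Infinite := by
      rw [← Set.infinite_coe_iff, Cardinal.infinite_iff, hE0c]
      exact hinf'
    obtain ⟨C, D, hC, hdCD, hcC, hcD, hbC⟩ : ∃ C D : Set X, C ⊆ E0 ∧ Disjoint C D ∧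
        #C = #E0 ∧ #D = #E0 ∧ g0 x ∉ C := by
      obtain ⟨C, D, h1, h2, h3, h4⟩ := aux_split _ hE0inf
      by_cases hb : g0 x ∈ C
      · exact ⟨D, C, h1 ▸ Set.subset_union_right, h2.symm, h4, h3,
          fun hb' => Set.disjoint_left.1 h2 hb hb'⟩
      · exact ⟨C, D, h1 ▸ Set.subset_union_left, h2, h3, h4, hb⟩
    obtain ⟨c0, hc0⟩ := aux_perm A B C D hdAB hdCD (hcA.trans hcB.symm) (hcC.trans hcD.symm)
      (by rw [hcA, hcC, hE0c]) (hcA ▸ hinf')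
    have hxA : x ∉ A := fun h => by
      have : x ∈ mvB x V0 := hAB ▸ Set.mem_union_left _ h
      exact this.1 rfl
    have hc0x : c0 x ∉ C := fun h => hxA ((hc0 x).1 h)
    set c := Equiv.swap (c0 x) (g0 x) * c0 with hcdef
    have hcx : c x = g0 x := by simp [hcdef]
    have hcA' : ∀ z ∈ A, c z ∈ C := by
      intro z hz
      have hz' := (hc0 z).2 hz
      have : c z = c0 z := by
        rw [hcdef, Equiv.Perm.mul_apply]
        apply Equiv.swap_apply_of_ne_of_ne
        · rintro h; exact hc0x (h ▸ hz')
        · rintro h; exact hbC (h ▸ hz')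
      rw [this]; exact hz'
    obtain ⟨g, hg, hgA⟩ := hpos _ (hconj V2 hV2 c)
    obtain ⟨e, ⟨_, p, hp, hpe⟩, hec⟩ := hE0 (hC (hcA' _ hgA))
    refine ⟨(Equiv.swap x y * p * (Equiv.swap x y)⁻¹) * ((c * g * c⁻¹) * g0),
      hV1U _ hp _ (hV2U _ hg _ hg0), ?_⟩
    have h1 : c⁻¹ (g0 x) = x := by rw [← hcx]; simp
    simp only [Equiv.Perm.mul_apply, h1, ← hec]
    simp [hpe]

open Cardinal in
theorem aux_min {X : Type*} (N : Filter (Equiv.Perm X)) (F : Set (Equiv.Perm X) → Set X) :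
    ∃ V ∈ N, ∀ U ∈ N, #(F V) ≤ #(F U) := by
  have hne : ((fun V => #(F V)) '' N.sets).Nonempty := ⟨_, Set.univ, N.univ_sets, rfl⟩
  obtain ⟨V, hV, h⟩ := csInf_mem hne
  refine ⟨V, hV, fun U hU => ?_⟩
  have h' : #(F V) = _ := h
  rw [h']
  exact csInf_le' ⟨U, hU, rfl⟩

/-- If the stabilizer of `x` is not in `N`, then every member of `N` moves `x` to any `y`. -/
theorem aux_trans {X : Type*} (N : Filter (Equiv.Perm X))
    (hmul : ∀ U ∈ N, ∃ V ∈ N, ∀ g ∈ V, ∀ h ∈ V, g * h ∈ U)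
    (hconj : ∀ U ∈ N, ∀ c : Equiv.Perm X, {g | c * g * c⁻¹ ∈ U} ∈ N)
    (x : X) (hx : ∀ U ∈ N, ∃ g ∈ U, g x ≠ x)
    (U : Set (Equiv.Perm X)) (hU : U ∈ N) (y : X) (hy : y ≠ x) : ∃ w ∈ U, w x = y := by
  classical
  obtain ⟨V1, hV1, hm1⟩ := aux_min N (mvB x)
  obtain ⟨V2, hV2, hm2⟩ := aux_min N (mvE x)
  rcases le_total (Cardinal.mk (mvB x V1)) (Cardinal.mk (mvE x V2)) with h | h
  · exact aux_trans1 N hmul hconj x hx V1 hV1 hm1 (fun U hU => h.trans (hm2 U hU)) U hU y hy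
  · have hBE : ∀ V : Set (Equiv.Perm X), mvB x (Inv.inv ⁻¹' V) = mvE x V := by
      intro V; ext b
      constructor
      · rintro ⟨hb, g, hg, hgb⟩
        exact ⟨hb, g⁻¹, hg, by rw [← hgb]; simp⟩
      · rintro ⟨hb, g, hg, hgb⟩
        exact ⟨hb, g⁻¹, by simpa using hg, by rw [← hgb]; simp⟩
    have hEB : ∀ V : Set (Equiv.Perm X), mvE x (Inv.inv ⁻¹' V) = mvB x V := by
      intro V
      rw [← hBE]; congr 1
    have key := aux_trans1 (N.map Inv.inv) ?_ ?_ x ?_ (Inv.inv ⁻¹' V2) ?_ ?_ ?_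
      {g | Equiv.swap x y * g⁻¹ * (Equiv.swap x y)⁻¹ ∈ U} ?_ y hy
    · obtain ⟨w, hw, hwx⟩ := key
      refine ⟨_, hw, ?_⟩
      have : w⁻¹ y = x := by rw [← hwx]; simp
      simp [Equiv.Perm.mul_apply] at this ⊢
      simp [this]
    · intro W hW
      obtain ⟨V, hV, hVW⟩ := hmul _ (Filter.mem_map.1 hW)
      refine ⟨Inv.inv ⁻¹' V, ?_, fun g hg h hh => ?_⟩
      · rw [Filter.mem_map]; convert hV using 1; ext g; simp
      · have := hVW _ hh _ hg
        simpa using this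
    · intro W hW c
      have := hconj _ (Filter.mem_map.1 hW) c
      rw [Filter.mem_map]
      convert this using 1
      ext g; simp [mul_assoc]
    · intro W hW
      obtain ⟨g, hg, hgx⟩ := hx _ (Filter.mem_map.1 hW)
      refine ⟨g⁻¹, hg, fun h => hgx ?_⟩
      conv_lhs => rw [← h]
      simp
    · rw [Filter.mem_map]; convert hV2 using 1; ext g; simp
    · intro W hW
      rw [hBE]
      have := hm2 _ (Filter.mem_map.1 hW)
      rwa [hEB] at this
    · intro W hW
      rw [hBE]
      have := h.trans (hm1 _ (Filter.mem_map.1 hW))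
      rwa [hBE] at this
    · rw [Filter.mem_map]
      convert hconj U hU (Equiv.swap x y) using 1
      ext g; simp

/-- Main filter argument: some (hence every) stabilizer belongs to `N`. -/
theorem aux_main {X : Type*} (N : Filter (Equiv.Perm X))
    (hmul : ∀ U ∈ N, ∃ V ∈ N, ∀ g ∈ V, ∀ h ∈ V, g * h ∈ U)
    (hconj : ∀ U ∈ N, ∀ c : Equiv.Perm X, {g | c * g * c⁻¹ ∈ U} ∈ N)
    (hT : ∀ a b : Equiv.Perm X, a ≠ b → {g | g * a ≠ b * g} ∈ N)
    (x y z : X) (hxy : x ≠ y) (hxz : x ≠ z) (hyz : y ≠ z) :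
    {g : Equiv.Perm X | g x = x} ∈ N := by
  classical
  by_contra hnot
  have hx : ∀ U ∈ N, ∃ g ∈ U, g x ≠ x := by
    intro U hU
    by_contra hc
    push Not at hc
    exact hnot (Filter.mem_of_superset hU hc)
  have hxy' : ∀ U ∈ N, ∃ w ∈ U, w x = y := fun U hU =>
    aux_trans N hmul hconj x hx U hU y hxy.symm
  have hyx : ∀ U ∈ N, ∃ w ∈ U, w y = x := by
    intro U hU
    obtain ⟨w, hw, hwx⟩ := hxy' _ (hconj U hU (Equiv.swap x y))
    exact ⟨_, hw, by simp [Equiv.Perm.mul_apply, hwx]⟩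
  by_cases hcase : ∃ U ∈ N, ∀ w ∈ U, w x = x → w z = z
  · obtain ⟨U, hU, hUf⟩ := hcase
    obtain ⟨V, hV, hVU⟩ := hmul U hU
    obtain ⟨w1, hw1, hw1x⟩ := hxy' V hV
    have hne : Equiv.swap y (w1 z) ≠ Equiv.swap x z := by
      intro h
      have := congrArg (fun s : Equiv.Perm X => s y) h
      simp only [Equiv.swap_apply_left, Equiv.swap_apply_of_ne_of_ne hxy.symm hyz] at this
      exact hxz (w1.injective (hw1x.trans this.symm))
    obtain ⟨w2, ⟨hw2, hw2n⟩, hw2y⟩ := hyx _ (Filter.inter_mem hV (hT _ _ hne))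
    have h3 := hUf _ (hVU _ hw2 _ hw1) (by simp [Equiv.Perm.mul_apply, hw1x, hw2y])
    rw [Equiv.Perm.mul_apply] at h3
    apply hw2n
    rw [Equiv.mul_swap_eq_swap_mul, hw2y, h3]
  · push Not at hcase
    have hne : Equiv.swap x z ≠ Equiv.swap x y := by
      intro h
      have := congrArg (fun s : Equiv.Perm X => s x) h
      simp only [Equiv.swap_apply_left] at this
      exact hyz this.symm
    let φ : Equiv.Perm {a : X // a ≠ x} →* Equiv.Perm X := Equiv.Perm.ofSubtype
    have key := aux_trans (N.comap φ) ?_ ?_ ⟨z, hxz.symm⟩ ?_ (φ ⁻¹' _)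
      (Filter.preimage_mem_comap (hT _ _ hne)) ⟨y, hxy.symm⟩ (by simpa using hyz)
    · obtain ⟨w, hw, hwz⟩ := key
      apply hw
      have h1 : φ w x = x := Equiv.Perm.ofSubtype_apply_of_not_mem w (by simp)
      have h2 : φ w z = y := by
        rw [show φ w z = _ from Equiv.Perm.ofSubtype_apply_of_mem w hxz.symm, hwz]
      rw [Equiv.mul_swap_eq_swap_mul, h1, h2]
    · intro W hW
      obtain ⟨T, hT', hTW⟩ := Filter.mem_comap.1 hW
      obtain ⟨V, hV, hVT⟩ := hmul T hT'
      refine ⟨φ ⁻¹' V, Filter.preimage_mem_comap hV, fun g hg h hh => hTW ?_⟩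
      have := hVT _ hg _ hh
      rwa [← map_mul] at this
    · intro W hW c
      obtain ⟨T, hT', hTW⟩ := Filter.mem_comap.1 hW
      refine Filter.mem_comap.2 ⟨_, hconj T hT' (φ c), fun g hg => hTW ?_⟩
      have hg' : φ c * φ g * (φ c)⁻¹ ∈ T := hg
      rwa [← map_inv, ← map_mul, ← map_mul] at hg'
    · intro W hW
      obtain ⟨T, hT', hTW⟩ := Filter.mem_comap.1 hW
      obtain ⟨w, hw, hwx, hwz⟩ := hcase T hT'
      have hp : ∀ a, w a ≠ x ↔ a ≠ x := fun a => by
        rw [not_iff_not]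
        constructor
        · intro h; exact w.injective (h.trans hwx.symm)
        · rintro rfl; exact hwx
      refine ⟨w.subtypePerm hp, hTW ?_, ?_⟩
      · have : φ (w.subtypePerm hp) = w := by
          apply Equiv.Perm.ofSubtype_subtypePerm
          intro a ha hax
          exact ha (hax ▸ hwx)
        rw [Set.mem_preimage, this]; exact hw
      · intro h
        exact hwz (congrArg Subtype.val h)

/-- Every Hausdorff topology on `Sym(X)` with continuous multiplication contains the topology
of pointwise convergence. -/
theorem statement9 (X : Type*) (t : TopologicalSpace (Equiv.Perm X))
    (hT2 : @T2Space (Equiv.Perm X) t)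
    (hmul : @Continuous (Equiv.Perm X × Equiv.Perm X) (Equiv.Perm X)
      (@instTopologicalSpaceProd _ _ t t) t (fun p => p.1 * p.2))
    (U : Set (Equiv.Perm X)) (hU : IsOpen[permPtwise X] U) :
    IsOpen[t] U := by
  classical
  have hc : ContinuousMul (Equiv.Perm X) := ⟨hmul⟩
  have hstab : ∀ x : X, {g : Equiv.Perm X | g x = x} ∈ 𝓝 (1 : Equiv.Perm X) := by
    intro x
    by_cases h3 : ∃ y z : X, x ≠ y ∧ x ≠ z ∧ y ≠ z
    · obtain ⟨y, z, hxy, hxz, hyz⟩ := h3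
      refine aux_main (𝓝 1) ?_ ?_ ?_ x y z hxy hxz hyz
      · intro W hW
        have h1 : Filter.Tendsto (fun p : Equiv.Perm X × Equiv.Perm X => p.1 * p.2)
            (𝓝 1 ×ˢ 𝓝 1) (𝓝 1) := by
          have := hmul.tendsto (1, 1)
          rwa [nhds_prod_eq, mul_one] at this
        obtain ⟨V, hV, hVW⟩ := Filter.mem_prod_same_iff.1 (h1 hW)
        exact ⟨V, hV, fun g hg h hh => hVW (Set.mk_mem_prod hg hh)⟩
      · intro W hW c
        have h1 : Continuous (fun g : Equiv.Perm X => c * g * c⁻¹) := by fun_prop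
        have h2 := h1.tendsto 1
        simp only [mul_one, mul_inv_cancel] at h2
        exact h2 hW
      · intro a b hab
        apply IsOpen.mem_nhds
        · exact isOpen_ne_fun (by fun_prop) (by fun_prop)
        · simpa using hab
    · push Not at h3
      have hfin : Finite X := by
        by_cases hy : ∃ y, x ≠ y
        · obtain ⟨y, hy⟩ := hy
          apply Set.finite_univ_iff.1
          apply (Set.toFinite {x, y}).subset
          intro z _
          by_cases hz : x = z
          · simp [hz]
          · simp [h3 y z hy hz]
        · push Not at hy
          apply Set.finite_univ_iff.1
          apply (Set.toFinite {x}).subset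
          intro z _
          simp [hy z]
      have : DiscreteTopology (Equiv.Perm X) := inferInstance
      exact (isOpen_discrete _).mem_nhds (by simp)
  have hle : t ≤ permPtwise X := by
    letI : TopologicalSpace X := ⊥
    haveI : DiscreteTopology X := ⟨rfl⟩
    rw [permPtwise, ← continuous_iff_le_induced]
    refine continuous_pi fun x => ?_
    rw [continuous_iff_continuousAt]
    intro g0
    rw [ContinuousAt, nhds_discrete X, Filter.tendsto_pure]
    have h1 : Continuous (fun g : Equiv.Perm X => g0⁻¹ * g) := by fun_prop
    have h2 := h1.tendsto g0
    simp only [inv_mul_cancel] at h2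
    filter_upwards [h2 (hstab x)] with g hg
    have hg' : g0⁻¹ (g x) = x := hg
    conv_rhs => rw [← hg']
    simp
  exact hle U hU
end
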